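/- arXiv:1307.3282 — 10 statements merged into one kernel-verified Lean document; each statement's English description precedes it below -/
import Mathlib

section
/- For a matrix A with entries in {0,1}, the following two conditions are equivalent: (i) the all-ones vector 1 belongs to the row space R(A) of A; (ii) there exists a nonnegative real matrix à with the same row space, R(Ã) = R(A), whose rows add up to c·1 for some positive integer c (i.e., every column sum of à equals c). -/
/-- For a 0-1 matrix `A`, the all-ones vector belongs to the row space of `A`
iff there exists a nonnegative real matrix with the same row space whose rows add up to `c·1`
for some positive integer `c`. -/
theorem overall_effect_iff_constant_row_sums {J n : ℕ}
    (A : Fin J → Fin n → ℝ) (hA : ∀ j i, A j i = 0 ∨ A j i = 1) :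
    ((fun _ : Fin n => (1 : ℝ)) ∈ Submodule.span ℝ (Set.range A)) ↔
      ∃ (J' : ℕ) (B : Fin J' → Fin n → ℝ) (c : ℕ), 0 < c ∧
        (∀ j i, 0 ≤ B j i) ∧
        Submodule.span ℝ (Set.range B) = Submodule.span ℝ (Set.range A) ∧
        (∀ i, ∑ j, B j i = (c : ℝ)) := by
  constructor
  · intro h
    set u : Fin n → ℝ := fun _ => 1
    set r : Fin n → ℝ := ((J + 1 : ℕ) : ℝ) • u - ∑ j, A j with hr
    have hr_mem : r ∈ Submodule.span ℝ (Set.range A) :=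
      sub_mem (Submodule.smul_mem _ _ h)
        (sum_mem fun j _ => Submodule.subset_span ⟨j, rfl⟩)
    refine ⟨J + 1, Fin.cons r A, J + 1, J.succ_pos, ?_, ?_, ?_⟩
    · intro j i
      refine Fin.cases ?_ (fun j => ?_) j
      · have hle : ∑ j, A j i ≤ ∑ _j : Fin J, (1 : ℝ) :=
          Finset.sum_le_sum fun j _ => by rcases hA j i with h | h <;> simp [h]
        simp only [Finset.sum_const, Finset.card_univ, Fintype.card_fin, nsmul_eq_mul,
          mul_one] at hle
        simp only [Fin.cons_zero, hr, u, Pi.sub_apply, Pi.smul_apply, Finset.sum_apply,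
          smul_eq_mul, mul_one]
        push_cast
        linarith
      · rw [Fin.cons_succ]
        rcases hA j i with h | h <;> simp [h]
    · rw [Fin.range_cons, Submodule.span_insert_eq_span hr_mem]
    · intro i
      simp [Fin.sum_univ_succ, hr, u]
  · rintro ⟨J', B, c, hc, -, hspan, hsum⟩
    have hc' : (c : ℝ) ≠ 0 := by positivity
    have hone : (fun _ : Fin n => (1 : ℝ)) = (c : ℝ)⁻¹ • ∑ j, B j := by
      ext i
      simp [hsum i, hc']
    rw [← hspan, hone]
    exact Submodule.smul_mem _ _ (sum_mem fun j _ => Submodule.subset_span ⟨j, rfl⟩)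
end

section
/- Let u ∈ ℝⁿ have strictly positive entries, let a ∈ {0,1}ⁿ be a nonzero 0-1 vector, and let c > 0. Define ζ* ∈ ℝⁿ by ζ*(i) = u(i)·(c/(a·u))^{a_i}, where a·u = Σ_i a_i u(i). Then ζ* is the unique minimizer of the Bregman divergence D(ζ‖u) over the set {ζ ∈ ℝⁿ : ζ(i) > 0 for all i, a·ζ = c}. -/
theorem Real.sub_lt_mul_log_div {s t : ℝ} (hs : 0 < s) (ht : 0 < t) (hst : s ≠ t) :
    s - t < s * Real.log (s / t) := by
  have h : Real.log (t / s) < t / s - 1 :=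
    Real.log_lt_sub_one_of_pos (by positivity) fun h => hst ((div_eq_one_iff_eq hs.ne').1 h).symm
  have h' := mul_lt_mul_of_pos_left h hs
  rw [mul_sub, mul_div_cancel₀ _ hs.ne', mul_one] at h'
  rw [← inv_div, Real.log_inv]
  linarith

theorem Real.sub_le_mul_log_div {s t : ℝ} (hs : 0 < s) (ht : 0 < t) :
    s - t ≤ s * Real.log (s / t) := by
  rcases eq_or_ne s t with rfl | hst
  · simp [hs.ne']
  · exact (Real.sub_lt_mul_log_div hs ht hst).le

/-- The single IPF update `ζ*(i) = u(i)·(c/(a·u))^{a i}` is the unique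
minimizer of the Bregman divergence `D(ζ‖u)` over the positive vectors with `a·ζ = c`. -/
theorem ipf_update_is_unique_bregman_projection {n : ℕ}
    (u a : Fin n → ℝ) (c : ℝ)
    (hu : ∀ i, 0 < u i) (ha : ∀ i, a i = 0 ∨ a i = 1) (ha0 : a ≠ 0) (hc : 0 < c)
    (D : (Fin n → ℝ) → (Fin n → ℝ) → ℝ)
    (hD : ∀ t v, D t v =
      ∑ i, t i * Real.log (t i / v i) + (∑ i, v i - ∑ i, t i))
    (ζs : Fin n → ℝ)
    (hζs : ∀ i, ζs i = u i * (c / ∑ k, a k * u k) ^ (a i)) :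
    (∀ i, 0 < ζs i) ∧ (∑ i, a i * ζs i = c) ∧
      ∀ ζ : Fin n → ℝ, (∀ i, 0 < ζ i) → (∑ i, a i * ζ i = c) → ζ ≠ ζs →
        D ζs u < D ζ u := by
  have hS : 0 < ∑ k, a k * u k := by
    obtain ⟨j, hj⟩ := Function.ne_iff.1 ha0
    have haj : a j = 1 := (ha j).resolve_left hj
    refine Finset.sum_pos' (fun i _ => ?_) ⟨j, Finset.mem_univ j, ?_⟩
    · rcases ha i with h | h <;> simp [h, (hu i).le]
    · simpa [haj] using hu j
  set S := ∑ k, a k * u k with hS_def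
  have hr : 0 < c / S := div_pos hc hS
  have hpos : ∀ i, 0 < ζs i := fun i => by
    rw [hζs]
    exact mul_pos (hu i) (Real.rpow_pos_of_pos hr _)
  have hsum : ∑ i, a i * ζs i = c := by
    have h : ∀ i, a i * ζs i = a i * u i * (c / S) := fun i => by
      rw [hζs]
      rcases ha i with h | h <;> simp [h]
    simp_rw [h]
    rw [← Finset.sum_mul, ← hS_def, mul_div_cancel₀ _ hS.ne']
  refine ⟨hpos, hsum, fun ζ hζ hζc hne => ?_⟩
  obtain ⟨L, hlog⟩ : ∃ L, ∀ i, Real.log (ζs i / u i) = a i * L := ⟨Real.log (c / S), fun i => by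
    rw [hζs, mul_div_cancel_left₀ _ (hu i).ne', Real.log_rpow hr]⟩
  have hs : ∑ i, ζs i * Real.log (ζs i / u i) = c * L := by
    rw [← hsum, Finset.sum_mul]
    exact Finset.sum_congr rfl fun i _ => by rw [hlog]; ring
  have ht : ∑ i, ζ i * Real.log (ζ i / u i) =
      ∑ i, ζ i * Real.log (ζ i / ζs i) + c * L := by
    conv_rhs => rw [← hζc]
    rw [Finset.sum_mul, ← Finset.sum_add_distrib]
    refine Finset.sum_congr rfl fun i _ => ?_
    rw [← div_mul_div_cancel₀ (hpos i).ne', Real.log_mul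
      (div_pos (hζ i) (hpos i)).ne' (div_pos (hpos i) (hu i)).ne', hlog]
    ring
  obtain ⟨j, hj⟩ := Function.ne_iff.1 hne
  have hlt : ∑ i, (ζ i - ζs i) < ∑ i, ζ i * Real.log (ζ i / ζs i) :=
    Finset.sum_lt_sum (fun i _ => Real.sub_le_mul_log_div (hζ i) (hpos i))
      ⟨j, Finset.mem_univ j, Real.sub_lt_mul_log_div (hζ j) (hpos j) hj⟩
  rw [Finset.sum_sub_distrib] at hlt
  rw [hD, hD, hs, ht]
  linarith
end

section
/- Suppose there exists δ⁰ ∈ ℝⁿ with strictly positive entries such that A δ⁰ = γ·A q and log δ⁰ ∈ rowspace(A) (equivalently D log δ⁰ = 0). Then the IPF(γ) sequence δ⁽ᵈ⁾ converges as d → ∞ to a limit δ*_γ ∈ ℝⁿ with strictly positive entries satisfying (i) A δ*_γ = γ·A q and (ii) D log δ*_γ = 0, where D is any kernel basis matrix of A. -/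
open Filter Topology

/-- The scalar generalized Kullback–Leibler divergence between positive reals. -/
noncomputable def scalarKL (b s : ℝ) : ℝ := b * (Real.log b - Real.log s) - b + s

lemma sq_sqrt_sub_sqrt_le_scalarKL {b s : ℝ} (hb : 0 < b) (hs : 0 < s) :
    (√b - √s) ^ 2 ≤ scalarKL b s := by
  have hb' := Real.sqrt_pos.2 hb
  have hs' := Real.sqrt_pos.2 hs
  have h1 := Real.log_le_sub_one_of_pos (div_pos hs' hb')
  rw [Real.log_div hs'.ne' hb'.ne', Real.log_sqrt hs.le, Real.log_sqrt hb.le] at h1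
  have h2 : b * (√s / √b) = √b * √s := by
    nth_rewrite 1 [← Real.mul_self_sqrt hb.le]
    field_simp
  have h3 := mul_le_mul_of_nonneg_left h1 hb.le
  have h4 := Real.sq_sqrt hb.le
  have h5 := Real.sq_sqrt hs.le
  unfold scalarKL
  nlinarith

lemma scalarKL_nonneg {b s : ℝ} (hb : 0 < b) (hs : 0 < s) : 0 ≤ scalarKL b s :=
  (sq_nonneg _).trans (sq_sqrt_sub_sqrt_le_scalarKL hb hs)

lemma le_of_scalarKL_le {b s K : ℝ} (hb : 0 < b) (hs : 0 < s) (h : scalarKL b s ≤ K) :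
    s ≤ (√b + √K) ^ 2 := by
  have h1 := Real.abs_le_sqrt ((sq_sqrt_sub_sqrt_le_scalarKL hb hs).trans h)
  have h2 := (abs_le.1 h1).1
  rw [← Real.sq_sqrt hs.le]
  exact pow_le_pow_left₀ (Real.sqrt_nonneg s) (by linarith) 2

lemma exp_le_of_scalarKL_le {b s K : ℝ} (hb : 0 < b) (hs : 0 < s) (h : scalarKL b s ≤ K) :
    Real.exp (Real.log b - (K + b) / b) ≤ s := by
  rw [← Real.le_log_iff_exp_le hs, sub_le_comm, le_div_iff₀ hb]
  unfold scalarKL at h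
  linarith

lemma abs_sub_le_of_scalarKL {b s B : ℝ} (hb : 0 < b) (hs : 0 < s) (hbB : b ≤ B) (hsB : s ≤ B) :
    |b - s| ≤ √(scalarKL b s) * (2 * √B) := by
  have h1 := Real.abs_le_sqrt (sq_sqrt_sub_sqrt_le_scalarKL hb hs)
  have h2 : b - s = (√b - √s) * (√b + √s) := by
    linear_combination -(Real.sq_sqrt hb.le) + Real.sq_sqrt hs.le
  rw [h2, abs_mul, abs_of_nonneg (add_nonneg (Real.sqrt_nonneg b) (Real.sqrt_nonneg s))]
  have h3 := Real.sqrt_le_sqrt hbB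
  have h4 := Real.sqrt_le_sqrt hsB
  exact mul_le_mul h1 (by linarith) (by positivity) (Real.sqrt_nonneg _)

/-- If the steps of a cyclic iteration vanish and each step drives one constraint, then
all constraints are satisfied asymptotically. -/
lemma tendsto_constraint_of_cyclic {J n : ℕ} (hJ : 0 < J) (A : Fin J → Fin n → ℝ)
    (hA : ∀ j i, A j i = 0 ∨ A j i = 1) (b : Fin J → ℝ) (δ : ℕ → Fin n → ℝ) (e : ℕ → ℝ)
    (he : Tendsto e atTop (𝓝 0))
    (hfit : ∀ d, |b ⟨d % J, Nat.mod_lt d hJ⟩ - ∑ k, A ⟨d % J, Nat.mod_lt d hJ⟩ k * δ d k| ≤ e d)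
    (hstep : ∀ d i, |δ (d + 1) i - δ d i| ≤ e d) (j : Fin J) :
    Tendsto (fun d => ∑ i, A j i * δ d i) atTop (𝓝 (b j)) := by
  have he0 : ∀ d, 0 ≤ e d := fun d => (abs_nonneg _).trans (hfit d)
  set E : ℕ → ℝ := fun d => ∑ k ∈ Finset.range J, e (d + k)
  have hE : Tendsto E atTop (𝓝 0) := by
    have := tendsto_finsetSum (Finset.range J)
      (fun k _ => he.comp (tendsto_add_atTop_nat k))
    simpa [E, Function.comp_def] using this
  have hdist : ∀ d i k, |δ (d + k) i - δ d i| ≤ ∑ l ∈ Finset.range k, e (d + l) := by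
    intro d i k
    induction k with
    | zero => simp
    | succ k ih =>
      rw [Finset.sum_range_succ]
      have h := abs_sub_le (δ (d + (k + 1)) i) (δ (d + k) i) (δ d i)
      have h' := hstep (d + k) i
      rw [add_assoc] at h'
      linarith
  have hnext : ∀ d, ∃ k < J, (d + k) % J = j := by
    intro d
    have hd := Nat.mod_lt d hJ
    have hj := j.2
    by_cases h : d % J ≤ j
    · refine ⟨j - d % J, by omega, ?_⟩
      rw [Nat.add_mod, Nat.mod_eq_of_lt (show (j : ℕ) - d % J < J by omega),
        Nat.add_sub_cancel' h, Nat.mod_eq_of_lt hj]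
    · refine ⟨j + J - d % J, by omega, ?_⟩
      rw [Nat.add_mod, Nat.mod_eq_of_lt (show (j : ℕ) + J - d % J < J by omega),
        Nat.add_sub_cancel' (by omega), Nat.add_mod_right, Nat.mod_eq_of_lt hj]
  rw [tendsto_iff_norm_sub_tendsto_zero]
  refine squeeze_zero (g := fun d => (n + 1) * E d) (fun d => norm_nonneg _) ?_
    (by simpa using hE.const_mul ((n : ℝ) + 1))
  intro d
  obtain ⟨k, hk, hkj⟩ := hnext d
  have hb := hfit (d + k)
  have hidx : (⟨(d + k) % J, Nat.mod_lt (d + k) hJ⟩ : Fin J) = j := Fin.ext hkj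
  rw [hidx] at hb
  have hek : e (d + k) ≤ E d :=
    Finset.single_le_sum (f := fun k => e (d + k)) (fun l _ => he0 (d + l))
      (Finset.mem_range.2 hk)
  have hsum : |∑ i, A j i * δ (d + k) i - ∑ i, A j i * δ d i| ≤ n * E d := by
    rw [← Finset.sum_sub_distrib]
    refine (Finset.abs_sum_le_sum_abs _ _).trans ?_
    have : ∀ i ∈ Finset.univ, |A j i * δ (d + k) i - A j i * δ d i| ≤ E d := by
      intro i _
      have h1 : |δ (d + k) i - δ d i| ≤ E d :=
        (hdist d i k).trans (Finset.sum_le_sum_of_subset_of_nonneg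
          (Finset.range_mono hk.le) (fun l _ _ => he0 _))
      rcases hA j i with h | h
      · simpa [h] using (abs_nonneg _).trans h1
      · simpa [h] using h1
    simpa using Finset.sum_le_card_nsmul _ _ _ this
  rw [Real.norm_eq_abs, abs_le]
  rw [abs_le] at hb hsum
  constructor <;> linarith [hb.1, hb.2, hsum.1, hsum.2]

lemma sub_mul_log_sub_log_nonneg {x y : ℝ} (hx : 0 < x) (hy : 0 < y) :
    0 ≤ (x - y) * (Real.log x - Real.log y) := by
  rcases le_total x y with h | h
  · exact mul_nonneg_of_nonpos_of_nonpos (by linarith) (by linarith [Real.log_le_log hx h])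
  · exact mul_nonneg (by linarith) (by linarith [Real.log_le_log hy h])

/-- Positive vectors whose logarithmic difference is orthogonal to their difference coincide. -/
lemma eq_of_sum_sub_mul_log_sub_log_eq_zero {n : ℕ} {x y : Fin n → ℝ} (hx : ∀ i, 0 < x i)
    (hy : ∀ i, 0 < y i) (h : ∑ i, (x i - y i) * (Real.log (x i) - Real.log (y i)) = 0) :
    x = y := by
  funext i
  have h1 := (Finset.sum_eq_zero_iff_of_nonneg
    (fun i _ => sub_mul_log_sub_log_nonneg (hx i) (hy i))).1 h i (Finset.mem_univ i)
  rcases mul_eq_zero.1 h1 with h2 | h2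
  · linarith
  · exact Real.log_injOn_pos (hx i) (hy i) (by linarith)

lemma sum_mul_eq_zero_of_mem_span {J n : ℕ} {A : Fin J → Fin n → ℝ} {v x : Fin n → ℝ}
    (hx : ∀ j, ∑ i, A j i * x i = 0) (hv : v ∈ Submodule.span ℝ (Set.range A)) :
    ∑ i, x i * v i = 0 := by
  induction hv using Submodule.span_induction with
  | mem v hv =>
    obtain ⟨j, rfl⟩ := hv
    simpa [mul_comm] using hx j
  | zero => simp
  | add v w _ _ hv hw => simp [mul_add, Finset.sum_add_distrib, hv, hw]
  | smul a v _ hv =>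
    have : ∑ i, x i * (a • v) i = a * ∑ i, x i * v i := by
      rw [Finset.mul_sum]
      exact Finset.sum_congr rfl fun i _ => by simp; ring
    rw [this, hv, mul_zero]

/-- If there is a strictly positive `δ⁰` with `A δ⁰ = γ·A q` and
`log δ⁰ ∈ rowspace A`, then the IPF(γ) sequence converges to a strictly positive limit
`δ*` with `A δ* = γ·A q` and `D log δ* = 0` for a kernel basis matrix `D` of `A`. -/
theorem ipf_gamma_converges {J n m : ℕ} (hJ : 0 < J)
    (A : Fin J → Fin n → ℝ) (hA : ∀ j i, A j i = 0 ∨ A j i = 1)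
    (hrows : ∀ j, ∃ i, A j i = 1)
    (q : Fin n → ℝ) (hq : ∀ i, 0 < q i) (γ : ℝ) (hγ : 0 < γ)
    -- `D` is a kernel basis matrix of `A`: its rows are independent, lie in `ker A`,
    -- and span `ker A`.
    (D : Fin m → Fin n → ℝ)
    (hDker : ∀ k j, ∑ i, A j i * D k i = 0)
    (hDind : LinearIndependent ℝ D)
    (hDspan : ∀ x : Fin n → ℝ, (∀ j, ∑ i, A j i * x i = 0) →
      x ∈ Submodule.span ℝ (Set.range D))
    -- the IPF(γ) sequence
    (δ : ℕ → Fin n → ℝ)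
    (hδ0 : ∀ i, δ 0 i = 1)
    (hrec : ∀ d i, δ (d + 1) i =
      δ d i * (γ * (∑ k, A ⟨d % J, Nat.mod_lt d hJ⟩ k * q k) /
        (∑ k, A ⟨d % J, Nat.mod_lt d hJ⟩ k * δ d k)) ^ (A ⟨d % J, Nat.mod_lt d hJ⟩ i))
    -- existence of a strictly positive point of `𝓛(A,q,γ) ∩ 𝓜(A)`
    (δ0 : Fin n → ℝ) (hδ0pos : ∀ i, 0 < δ0 i)
    (hδ0fit : ∀ j, ∑ i, A j i * δ0 i = γ * ∑ i, A j i * q i)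
    (hδ0row : (fun i => Real.log (δ0 i)) ∈ Submodule.span ℝ (Set.range A)) :
    ∃ δs : Fin n → ℝ, (∀ i, 0 < δs i) ∧
      (∀ i, Filter.Tendsto (fun d => δ d i) Filter.atTop (nhds (δs i))) ∧
      (∀ j, ∑ i, A j i * δs i = γ * ∑ i, A j i * q i) ∧
      (∀ k, ∑ i, D k i * Real.log (δs i) = 0) := by
  set b : Fin J → ℝ := fun j => γ * ∑ i, A j i * q i with hb
  set r : ℕ → Fin J := fun d => ⟨d % J, Nat.mod_lt d hJ⟩ with hr
  set s : ℕ → ℝ := fun d => ∑ k, A (r d) k * δ d k with hs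
  have hrec' : ∀ d i, δ (d + 1) i = δ d i * (b (r d) / s d) ^ (A (r d) i) := hrec
  have hrowpos : ∀ j (x : Fin n → ℝ), (∀ i, 0 < x i) → 0 < ∑ i, A j i * x i := by
    intro j x hx
    obtain ⟨i, hi⟩ := hrows j
    refine Finset.sum_pos' (fun k _ => ?_) ⟨i, Finset.mem_univ i, by simpa [hi] using hx i⟩
    rcases hA j k with h | h <;> simp [h, (hx k).le]
  have hbpos : ∀ j, 0 < b j := fun j => mul_pos hγ (hrowpos j q hq)
  have hpos : ∀ d i, 0 < δ d i := by
    intro d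
    induction d with
    | zero => simp [hδ0]
    | succ d ih =>
      intro i
      rw [hrec']
      exact mul_pos (ih i) (Real.rpow_pos_of_pos (div_pos (hbpos _) (hrowpos _ _ ih)) _)
  have hspos : ∀ d, 0 < s d := fun d => hrowpos _ _ (hpos d)
  have hlog : ∀ d i, Real.log (δ (d + 1) i) =
      Real.log (δ d i) + A (r d) i * (Real.log (b (r d)) - Real.log (s d)) := by
    intro d i
    have h := div_pos (hbpos (r d)) (hspos d)
    rw [hrec', Real.log_mul (hpos d i).ne' (Real.rpow_pos_of_pos h _).ne', Real.log_rpow h,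
      Real.log_div (hbpos _).ne' (hspos d).ne']
  have hdiff : ∀ d i, δ (d + 1) i = δ d i + A (r d) i * δ d i * ((b (r d) - s d) / s d) := by
    intro d i
    have := (hspos d).ne'
    rw [hrec']
    rcases hA (r d) i with h | h
    · simp [h]
    · rw [h, Real.rpow_one]
      field_simp
      ring
  have horth : ∀ x : Fin n → ℝ, (∀ j, ∑ i, A j i * x i = 0) →
      ∀ d, ∑ i, x i * Real.log (δ d i) = 0 := by
    intro x hx d
    induction d with
    | zero => simp [hδ0]
    | succ d ih =>
      have : ∑ i, x i * Real.log (δ (d + 1) i) = ∑ i, x i * Real.log (δ d i) +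
          (∑ i, A (r d) i * x i) * (Real.log (b (r d)) - Real.log (s d)) := by
        rw [Finset.sum_mul, ← Finset.sum_add_distrib]
        exact Finset.sum_congr rfl fun i _ => by rw [hlog]; ring
      rw [this, ih, hx, zero_mul, add_zero]
  -- The divergence from `δ0` decreases by exactly the scalar divergence of the fitted margin.
  set K : ℕ → ℝ := fun d => ∑ i, scalarKL (δ0 i) (δ d i) with hK
  have hKstep : ∀ d, K (d + 1) = K d - scalarKL (b (r d)) (s d) := by
    intro d
    have h1 : K (d + 1) = K d - (∑ i, A (r d) i * δ0 i) *
        (Real.log (b (r d)) - Real.log (s d)) + s d * ((b (r d) - s d) / s d) := by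
      simp only [hK, hs]
      rw [Finset.sum_mul, Finset.sum_mul, ← Finset.sum_sub_distrib, ← Finset.sum_add_distrib]
      refine Finset.sum_congr rfl fun i _ => ?_
      unfold scalarKL
      rw [hlog, hdiff]
      ring
    rw [h1, hδ0fit, mul_div_cancel₀ _ (hspos d).ne']
    unfold scalarKL
    ring
  have hterm : ∀ d i, 0 ≤ scalarKL (δ0 i) (δ d i) := fun d i =>
    scalarKL_nonneg (hδ0pos i) (hpos d i)
  have hKanti : Antitone K := antitone_nat_of_succ_le fun d => by
    rw [hKstep]
    linarith [scalarKL_nonneg (hbpos (r d)) (hspos d)]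
  have hKle : ∀ d i, scalarKL (δ0 i) (δ d i) ≤ K 0 := fun d i =>
    (Finset.single_le_sum (f := fun i => scalarKL (δ0 i) (δ d i)) (fun i _ => hterm d i)
      (Finset.mem_univ i)).trans (hKanti (Nat.zero_le d))
  have hKlim : Tendsto K atTop (𝓝 (⨅ d, K d)) := tendsto_atTop_ciInf hKanti
    ⟨0, by rintro _ ⟨d, rfl⟩; exact Finset.sum_nonneg fun i _ => hterm d i⟩
  have hφ : Tendsto (fun d => scalarKL (b (r d)) (s d)) atTop (𝓝 0) := by
    have h := hKlim.sub (hKlim.comp (tendsto_add_atTop_nat 1))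
    simpa [Function.comp_def, hKstep] using h
  set lo : Fin n → ℝ := fun i => Real.exp (Real.log (δ0 i) - (K 0 + δ0 i) / δ0 i)
  set hi : Fin n → ℝ := fun i => (√(δ0 i) + √(K 0)) ^ 2
  have hmem : ∀ d, δ d ∈ Set.Icc lo hi := fun d =>
    ⟨fun i => exp_le_of_scalarKL_le (hδ0pos i) (hpos d i) (hKle d i),
      fun i => le_of_scalarKL_le (hδ0pos i) (hpos d i) (hKle d i)⟩
  have hrowle : ∀ j (x : Fin n → ℝ), (∀ i, 0 ≤ x i) → ∑ i, A j i * x i ≤ ∑ i, x i := by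
    intro j x hx
    refine Finset.sum_le_sum fun i _ => ?_
    rcases hA j i with h | h <;> simp [h, hx i]
  set B : ℝ := ∑ i, δ0 i + ∑ i, hi i
  have hδ0sum : 0 ≤ ∑ i, δ0 i := Finset.sum_nonneg fun i _ => (hδ0pos i).le
  have hhisum : 0 ≤ ∑ i, hi i := Finset.sum_nonneg fun i _ => sq_nonneg _
  have hbB : ∀ j, b j ≤ B := by
    intro j
    have h := hrowle j δ0 fun i => (hδ0pos i).le
    rw [hδ0fit] at h
    exact h.trans (le_add_of_nonneg_right hhisum)
  have hsB : ∀ d, s d ≤ B := fun d =>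
    ((hrowle _ _ fun i => (hpos d i).le).trans
      (Finset.sum_le_sum fun i _ => (hmem d).2 i)).trans (le_add_of_nonneg_left hδ0sum)
  have hgap : Tendsto (fun d => |b (r d) - s d|) atTop (𝓝 0) := by
    refine squeeze_zero (fun d => abs_nonneg _)
      (fun d => abs_sub_le_of_scalarKL (hbpos _) (hspos d) (hbB _) (hsB d)) ?_
    simpa using ((Real.continuous_sqrt.tendsto 0).comp hφ).mul_const (2 * √B)
  have hstep : ∀ d i, |δ (d + 1) i - δ d i| ≤ |b (r d) - s d| := by
    intro d i
    have h1 : A (r d) i * δ d i ≤ s d := by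
      refine Finset.single_le_sum (f := fun i => A (r d) i * δ d i) (fun k _ => ?_)
        (Finset.mem_univ i)
      rcases hA (r d) k with h | h <;> simp [h, (hpos d k).le]
    have h2 : 0 ≤ A (r d) i * δ d i := by
      rcases hA (r d) i with h | h <;> simp [h, (hpos d i).le]
    rw [hdiff, add_sub_cancel_left, abs_mul, abs_div, abs_of_nonneg h2, abs_of_pos (hspos d),
      mul_div_assoc', div_le_iff₀ (hspos d), mul_comm]
    exact mul_le_mul_of_nonneg_left h1 (abs_nonneg _)
  have hlim := tendsto_constraint_of_cyclic hJ A hA b δ _ hgap (fun d => le_rfl) hstep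
  have hconv : Tendsto δ atTop (𝓝 δ0) := by
    refine isCompact_Icc.tendsto_nhds_of_unique_mapClusterPt
      (Eventually.of_forall hmem) fun y hy hcl => ?_
    obtain ⟨U, hU, hUy⟩ := mapClusterPt_iff_ultrafilter.1 hcl
    have hyi : ∀ i, Tendsto (fun d => δ d i) U (𝓝 (y i)) := tendsto_pi_nhds.1 hUy
    have hypos : ∀ i, 0 < y i := fun i => (Real.exp_pos _).trans_le (hy.1 i)
    have hyfit : ∀ j, ∑ i, A j i * y i = b j := fun j =>
      tendsto_nhds_unique (tendsto_finsetSum _ fun i _ => (hyi i).const_mul (A j i))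
        ((hlim j).mono_left hU)
    have hker : ∀ j, ∑ i, A j i * (y i - δ0 i) = 0 := by
      intro j
      simp only [mul_sub, Finset.sum_sub_distrib]
      rw [hyfit, hδ0fit, sub_self]
    have hylog : ∑ i, (y i - δ0 i) * Real.log (y i) = 0 := by
      refine tendsto_nhds_unique (tendsto_finsetSum _ fun i _ =>
        ((hyi i).log (hypos i).ne').const_mul (y i - δ0 i)) ?_
      simp only [horth (fun i => y i - δ0 i) hker]
      exact tendsto_const_nhds
    have hδ0log := sum_mul_eq_zero_of_mem_span hker hδ0row
    refine eq_of_sum_sub_mul_log_sub_log_eq_zero hypos hδ0pos ?_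
    simp only [mul_sub, Finset.sum_sub_distrib] at hylog hδ0log ⊢
    simp only [sub_mul, Finset.sum_sub_distrib] at hylog hδ0log ⊢
    linarith
  exact ⟨δ0, hδ0pos, tendsto_pi_nhds.1 hconv, hδ0fit,
    fun k => sum_mul_eq_zero_of_mem_span (hDker k) hδ0row⟩
end

section
/- Assume the IPF(γ) sequence δ⁽ᵈ⁾ converges pointwise, as d → ∞, to a vector δ*_γ with strictly positive entries. Then for each j = 1,…,J the multiplicative-parameter sequence θ⁽ᵈ⁾(j) converges, as d → ∞, to some θ*_γ(j) > 0, and the limit satisfies δ*_γ(i) = Π_{j=1}^{J} (θ*_γ(j))^{a_{ji}} for all i ∈ {1,…,n}. -/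
open Filter Topology

/-- On a bounded range the gap `exp (-s) - 1 + s` dominates a multiple of `s ^ 2`. -/
lemma sq_le_mul_exp_neg_sub_one_add {s L : ℝ} (hs : |s| ≤ L) :
    s ^ 2 ≤ (4 + 2 * L) * (Real.exp (-s) - 1 + s) := by
  have hL : 0 ≤ L := (abs_nonneg s).trans hs
  have h0 : 0 ≤ Real.exp (-s) - 1 + s := by linarith [Real.add_one_le_exp (-s)]
  rcases le_total s 2 with h | h
  · have h1 : 1 - s / 2 ≤ Real.exp (-s / 2) := by linarith [Real.add_one_le_exp (-s / 2)]
    have h2 : Real.exp (-s) = Real.exp (-s / 2) ^ 2 := by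
      rw [← Real.exp_nat_mul]; congr 1; push_cast; ring
    have h3 : (1 - s / 2) ^ 2 ≤ Real.exp (-s) := by
      rw [h2]; exact pow_le_pow_left₀ (by linarith) h1 2
    nlinarith [mul_nonneg hL h0]
  · have h1 : s / 2 ≤ Real.exp (-s) - 1 + s := by linarith [Real.exp_pos (-s)]
    have h2 : s ≤ L := (le_abs_self s).trans hs
    nlinarith [mul_le_mul_of_nonneg_left h1 hL]

lemma exp_sub_exp_le_mul_sub (x y : ℝ) :
    Real.exp x - Real.exp y ≤ Real.exp x * (x - y) := by
  have h1 : Real.exp y = Real.exp x * Real.exp (y - x) := by rw [← Real.exp_add]; congr 1; ring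
  nlinarith [Real.add_one_le_exp (y - x), Real.exp_pos x]

lemma abs_exp_sub_exp_le {x y L : ℝ} (hx : |x| ≤ L) (hy : |y| ≤ L) :
    |Real.exp x - Real.exp y| ≤ Real.exp L * |x - y| := by
  wlog h : y ≤ x generalizing x y
  · rw [abs_sub_comm, abs_sub_comm x]; exact this hy hx (le_of_not_ge h)
  rw [abs_of_nonneg (sub_nonneg.2 (Real.exp_le_exp.2 h)), abs_of_nonneg (sub_nonneg.2 h)]
  exact (exp_sub_exp_le_mul_sub x y).trans (mul_le_mul_of_nonneg_right
    (Real.exp_le_exp.2 ((le_abs_self x).trans hx)) (sub_nonneg.2 h))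

lemma exp_neg_mul_sq_sub_le {x y L : ℝ} (hx : |x| ≤ L) (hy : |y| ≤ L) :
    Real.exp (-L) * (x - y) ^ 2 ≤ (Real.exp x - Real.exp y) * (x - y) := by
  wlog h : y ≤ x generalizing x y
  · linarith [this hy hx (le_of_not_ge h)]
  have h1 := exp_sub_exp_le_mul_sub y x
  have h2 : Real.exp (-L) ≤ Real.exp y := Real.exp_le_exp.2 (abs_le.1 hy).1
  have h3 := mul_le_mul_of_nonneg_right h2 (sub_nonneg.2 h)
  have h4 : Real.exp (-L) * (x - y) ≤ Real.exp x - Real.exp y := by linarith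
  nlinarith [mul_le_mul_of_nonneg_right h4 (sub_nonneg.2 h)]

lemma LinearMap.exists_bounded_preimage {E F : Type*} [NormedAddCommGroup E] [NormedSpace ℝ E]
    [NormedAddCommGroup F] [NormedSpace ℝ F] [FiniteDimensional ℝ F] (T : E →ₗ[ℝ] F) :
    ∃ C : ℝ, 0 < C ∧ ∀ w ∈ LinearMap.range T, ∃ v, T v = w ∧ ‖v‖ ≤ C * ‖w‖ := by
  obtain ⟨g, hg⟩ := T.rangeRestrict.exists_rightInverse_of_surjective T.range_rangeRestrict
  obtain ⟨C, hC, hb⟩ := (LinearMap.toContinuousLinearMap g).bound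
  refine ⟨C, hC, fun w hw => ⟨g ⟨w, hw⟩, ?_, hb ⟨w, hw⟩⟩⟩
  exact congrArg Subtype.val (LinearMap.congr_fun hg ⟨w, hw⟩)

/-- If a nonnegative sequence `D` is comparable to `S ^ 2` and drops by a multiple of `S ^ 2` over
each window of length `J`, then `S` is summable. -/
lemma summable_of_sq_le_sub_shift {D S : ℕ → ℝ} {J : ℕ} {K c : ℝ} (hK : 0 < K) (hc : 0 < c)
    (hD : ∀ d, 0 ≤ D d) (hS : ∀ d, 0 ≤ S d) (hDS : ∀ d, D d ≤ K ^ 2 * S d ^ 2)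
    (hSD : ∀ d, c * S d ^ 2 ≤ D d - D (d + J)) : Summable S := by
  have key : ∀ d, S d ≤ 2 * K / c * (√(D d) - √(D (d + J))) := by
    intro d
    have hdec : D (d + J) ≤ D d := by nlinarith [hSD d, sq_nonneg (S d)]
    have h1 : √(D (d + J)) ≤ √(D d) := Real.sqrt_le_sqrt hdec
    have h2 : √(D d) ≤ K * S d := Real.sqrt_le_iff.2 ⟨mul_nonneg hK.le (hS d), by
      rw [mul_pow]; exact hDS d⟩
    have h3 : c * S d ^ 2 ≤ (√(D d) - √(D (d + J))) * (2 * K * S d) := by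
      nlinarith [hSD d, Real.sq_sqrt (hD d), Real.sq_sqrt (hD (d + J)),
        mul_nonneg (sub_nonneg.2 h1) (sub_nonneg.2 (h1.trans h2)),
        mul_nonneg (sub_nonneg.2 h1) (sub_nonneg.2 h2)]
    rw [div_mul_eq_mul_div, le_div_iff₀ hc]
    rcases (hS d).eq_or_lt with h | h
    · rw [← h]; have := sub_nonneg.2 h1; simp only [zero_mul]; positivity
    · refine le_of_mul_le_mul_right ?_ h
      linarith
  refine summable_of_sum_range_le (c := 2 * K / c * ∑ d ∈ Finset.range J, √(D d)) hS fun N => ?_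
  refine (Finset.sum_le_sum fun d _ => key d).trans ?_
  rw [← Finset.mul_sum, Finset.sum_sub_distrib]
  refine mul_le_mul_of_nonneg_left ?_ (by positivity)
  have e1 := Finset.sum_range_add (fun d => √(D d)) J N
  have e2 : ∑ d ∈ Finset.range N, √(D d) ≤ ∑ d ∈ Finset.range (J + N), √(D d) :=
    Finset.sum_le_sum_of_subset_of_nonneg (Finset.range_mono (by omega))
      fun _ _ _ => Real.sqrt_nonneg _
  simp only [add_comm J] at e1 e2
  have e3 : ∀ d, √(D (J + d)) = √(D (d + J)) := fun d => by rw [add_comm]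
  simp only [add_comm J] at e3
  linarith

section CyclicScaling

variable {ι κ : Type*} [Fintype ι] [Fintype κ] {A : ι → κ → ℝ} {x : ℕ → κ → ℝ}
  {xs : κ → ℝ} {s : ℕ → ℝ} {idx : ℕ → ι} {J : ℕ}

/-- The generalized Kullback–Leibler divergence of `exp xs` from `exp y`. -/
noncomputable def expDivergence (xs y : κ → ℝ) : ℝ :=
  ∑ i, (Real.exp (y i) - Real.exp (xs i) - Real.exp (xs i) * (y i - xs i))

lemma expDivergence_nonneg (xs y : κ → ℝ) : 0 ≤ expDivergence xs y :=
  Finset.sum_nonneg fun i _ => by linarith [exp_sub_exp_le_mul_sub (xs i) (y i)]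

lemma expDivergence_le (xs y : κ → ℝ) :
    expDivergence xs y ≤ ∑ i, (Real.exp (y i) - Real.exp (xs i)) * (y i - xs i) :=
  Finset.sum_le_sum fun i _ => by linarith [exp_sub_exp_le_mul_sub (y i) (xs i)]

/-- The divergence is controlled by the marginal residuals along the row space. -/
lemma exists_expDivergence_le_sq_residual (A : ι → κ → ℝ) (L : ℝ) :
    ∃ C : ℝ, 0 < C ∧ ∀ xs y : κ → ℝ, (∀ i, |xs i| ≤ L) → (∀ i, |y i| ≤ L) →
      y - xs ∈ LinearMap.range (Matrix.vecMulLinear (Matrix.of A)) → ∀ R : ℝ, 0 ≤ R →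
      (∀ j, |∑ i, A j i * (Real.exp (y i) - Real.exp (xs i))| ≤ R) →
      expDivergence xs y ≤ C ^ 2 * R ^ 2 := by
  obtain ⟨C, hC, hT⟩ := (Matrix.vecMulLinear (Matrix.of A)).exists_bounded_preimage
  refine ⟨(Fintype.card ι + 1) * C * Real.exp (L / 2), by positivity, ?_⟩
  intro xs y hxs hy hmem R hR hres
  obtain ⟨v, hv, hvC⟩ := hT _ hmem
  set P := ∑ i, (Real.exp (y i) - Real.exp (xs i)) * (y i - xs i) with hP
  have hw : ∀ i, y i - xs i = ∑ j, v j * A j i := fun i => (congrFun hv i).symm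
  have hPR : P ≤ (Fintype.card ι + 1) * C * R * ‖y - xs‖ := by
    have h1 : P = ∑ j, v j * ∑ i, A j i * (Real.exp (y i) - Real.exp (xs i)) := by
      simp_rw [hP, hw, Finset.mul_sum]
      rw [Finset.sum_comm]
      exact Finset.sum_congr rfl fun _ _ => Finset.sum_congr rfl fun _ _ => by ring
    have h2 : P ≤ ∑ _j : ι, C * ‖y - xs‖ * R := by
      rw [h1]
      refine Finset.sum_le_sum fun j _ => (le_abs_self _).trans ?_
      rw [abs_mul]
      exact mul_le_mul ((norm_le_pi_norm v j).trans hvC) (hres j) (abs_nonneg _) (by positivity)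
    rw [Finset.sum_const, Finset.card_univ, nsmul_eq_mul] at h2
    have h3 : 0 ≤ C * ‖y - xs‖ * R := by positivity
    linarith
  have hnorm : Real.exp (-L) * ‖y - xs‖ ^ 2 ≤ P := by
    have h1 : ‖y - xs‖ ≤ √(∑ i, (y i - xs i) ^ 2) :=
      (pi_norm_le_iff_of_nonneg (Real.sqrt_nonneg _)).2 fun i => Real.abs_le_sqrt
        (Finset.single_le_sum (f := fun i => (y i - xs i) ^ 2)
          (fun _ _ => sq_nonneg _) (Finset.mem_univ i))
    have h2 : ‖y - xs‖ ^ 2 ≤ ∑ i, (y i - xs i) ^ 2 :=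
      (Real.le_sqrt (norm_nonneg _) (Finset.sum_nonneg fun _ _ => sq_nonneg _)).1 h1
    refine (mul_le_mul_of_nonneg_left h2 (Real.exp_pos _).le).trans ?_
    rw [Finset.mul_sum]
    exact Finset.sum_le_sum fun i _ => exp_neg_mul_sq_sub_le (hy i) (hxs i)
  refine (expDivergence_le xs y).trans ?_
  rw [← hP]
  have hP0 : 0 ≤ P := le_trans (by positivity) hnorm
  have hsq : P ^ 2 ≤ ((Fintype.card ι + 1) * C * R) ^ 2 * ‖y - xs‖ ^ 2 := by
    rw [← mul_pow]; exact pow_le_pow_left₀ hP0 hPR 2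
  have hexp : Real.exp (L / 2) ^ 2 * Real.exp (-L) = 1 := by
    rw [← Real.exp_nat_mul, ← Real.exp_add, Real.exp_eq_one_iff]; push_cast; ring
  have hnorm' : ‖y - xs‖ ^ 2 ≤ Real.exp (L / 2) ^ 2 * P := by
    have := mul_le_mul_of_nonneg_left hnorm (sq_nonneg (Real.exp (L / 2)))
    rwa [← mul_assoc, hexp, one_mul] at this
  rcases hP0.eq_or_lt with h | h
  · rw [← h]; positivity
  · refine le_of_mul_le_mul_right ?_ h
    have := mul_le_mul_of_nonneg_left hnorm' (sq_nonneg ((Fintype.card ι + 1) * C * R))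
    linarith

/-- In a cyclic scaling algorithm with convergent logarithms, the logarithmic step sizes are
absolutely summable. -/
lemma summable_abs_step_of_cyclic (hA : ∀ j i, A j i = 0 ∨ A j i = 1)
    (hrow : ∀ j, ∃ i, A j i = 1)
    (hx : ∀ d i, x (d + 1) i = x d i + A (idx d) i * s d)
    (hrange : ∀ d, x d ∈ LinearMap.range (Matrix.vecMulLinear (Matrix.of A)))
    (hlim : Tendsto x atTop (𝓝 xs))
    (hfit : ∀ d, ∑ i, A (idx d) i * Real.exp (x (d + 1) i) =
      ∑ i, A (idx d) i * Real.exp (xs i))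
    (hidx : ∀ d j, ∃ k < J, idx (d + k) = j) :
    Summable fun d => |s d| := by
  obtain ⟨L₀, hL₀⟩ := (Metric.isBounded_range_of_tendsto x hlim).exists_norm_le
  have hxL : ∀ d i, |x d i| ≤ L₀ := fun d i =>
    (norm_le_pi_norm (x d) i).trans (hL₀ _ ⟨d, rfl⟩)
  have hxsL : ∀ i, |xs i| ≤ L₀ := fun i =>
    le_of_tendsto ((tendsto_pi_nhds.1 hlim i).abs) (Eventually.of_forall fun d => hxL d i)
  have hL : 0 ≤ L₀ := (norm_nonneg (x 0)).trans (hL₀ _ ⟨0, rfl⟩)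
  have hsL : ∀ d, |s d| ≤ 2 * L₀ := by
    intro d
    obtain ⟨i, hi⟩ := hrow (idx d)
    have h1 : s d = x (d + 1) i - x d i := by rw [hx, hi]; ring
    rw [h1]
    linarith [abs_sub (x (d + 1) i) (x d i), hxL d i, hxL (d + 1) i]
  have hJ : 0 < J := by
    obtain ⟨k, hk, -⟩ := hidx 0 (idx 0)
    omega
  have hxs : xs ∈ LinearMap.range (Matrix.vecMulLinear (Matrix.of A)) :=
    (Submodule.closed_of_finiteDimensional _).mem_of_tendsto hlim (Eventually.of_forall hrange)
  obtain ⟨C, hC, hCR⟩ := exists_expDivergence_le_sq_residual A L₀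
  have hAnn : ∀ j i, 0 ≤ A j i ∧ A j i ≤ 1 := fun j i => by
    rcases hA j i with h | h <;> simp [h]
  set S : ℕ → ℝ := fun d => ∑ k ∈ Finset.range J, |s (d + k)|
  have hS0 : ∀ d, 0 ≤ S d := fun d => Finset.sum_nonneg fun _ _ => abs_nonneg _
  have hdist : ∀ d i m, |x d i - x (d + m) i| ≤ ∑ k ∈ Finset.range m, |s (d + k)| := by
    intro d i m
    induction m with
    | zero => simp
    | succ m ih =>
      rw [Finset.sum_range_succ, ← add_assoc, hx]
      have h1 : |A (idx (d + m)) i * s (d + m)| ≤ |s (d + m)| := by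
        rw [abs_mul, abs_of_nonneg (hAnn _ _).1]
        exact mul_le_of_le_one_left (abs_nonneg _) (hAnn _ _).2
      rw [← sub_sub]
      exact (abs_sub _ _).trans (add_le_add ih h1)
  have hres : ∀ d j, |∑ i, A j i * (Real.exp (x d i) - Real.exp (xs i))| ≤
      Fintype.card κ * Real.exp L₀ * S d := by
    intro d j
    obtain ⟨k, hk, rfl⟩ := hidx d j
    have h1 : ∑ i, A (idx (d + k)) i * (Real.exp (x d i) - Real.exp (xs i)) =
        ∑ i, A (idx (d + k)) i * (Real.exp (x d i) - Real.exp (x (d + (k + 1)) i)) := by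
      have := hfit (d + k)
      simp only [mul_sub, Finset.sum_sub_distrib]
      rw [← this, add_assoc]
    have h2 : ∀ i, |A (idx (d + k)) i * (Real.exp (x d i) - Real.exp (x (d + (k + 1)) i))| ≤
        Real.exp L₀ * S d := by
      intro i
      rw [abs_mul, abs_of_nonneg (hAnn _ _).1]
      refine (mul_le_of_le_one_left (abs_nonneg _) (hAnn _ _).2).trans ?_
      refine (abs_exp_sub_exp_le (hxL _ _) (hxL _ _)).trans ?_
      refine mul_le_mul_of_nonneg_left ((hdist d i (k + 1)).trans ?_) (Real.exp_pos _).le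
      exact Finset.sum_le_sum_of_subset_of_nonneg (Finset.range_mono hk)
        fun _ _ _ => abs_nonneg _
    rw [h1]
    refine (Finset.abs_sum_le_sum_abs _ _).trans ((Finset.sum_le_sum fun i _ => h2 i).trans ?_)
    rw [Finset.sum_const, Finset.card_univ, nsmul_eq_mul, mul_assoc]
  set c : ℝ := Real.exp (-L₀) / (4 + 2 * (2 * L₀)) with hc
  have hc0 : 0 < c := by positivity
  have hstep : ∀ d, c * s d ^ 2 ≤ expDivergence xs (x d) - expDivergence xs (x (d + 1)) := by
    intro d
    have h1 : expDivergence xs (x d) - expDivergence xs (x (d + 1)) =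
        (∑ i, A (idx d) i * Real.exp (xs i)) * (Real.exp (-s d) - 1 + s d) := by
      have h2 : (∑ i, A (idx d) i * Real.exp (xs i)) * (Real.exp (-s d) - 1 + s d) =
          (∑ i, A (idx d) i * Real.exp (x (d + 1) i)) * (Real.exp (-s d) - 1) +
          (∑ i, A (idx d) i * Real.exp (xs i)) * s d := by rw [hfit]; ring
      rw [h2, expDivergence, expDivergence, ← Finset.sum_sub_distrib, Finset.sum_mul,
        Finset.sum_mul, ← Finset.sum_add_distrib]
      refine Finset.sum_congr rfl fun i _ => ?_
      rw [hx]
      rcases hA (idx d) i with h | h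
      · simp [h]
      · have h3 : Real.exp (x d i) = Real.exp (x d i + s d) * Real.exp (-s d) := by
          rw [← Real.exp_add]; congr 1; ring
        rw [h, one_mul, h3]; ring
    have h4 : Real.exp (-L₀) ≤ ∑ i, A (idx d) i * Real.exp (xs i) := by
      obtain ⟨i, hi⟩ := hrow (idx d)
      have h5 := Finset.single_le_sum (f := fun i => A (idx d) i * Real.exp (xs i))
        (fun i _ => mul_nonneg (hAnn _ _).1 (Real.exp_pos _).le) (Finset.mem_univ i)
      simp only [hi, one_mul] at h5
      exact (Real.exp_le_exp.2 (abs_le.1 (hxsL i)).1).trans h5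
    have h6 := sq_le_mul_exp_neg_sub_one_add (hsL d)
    have h7 : 0 ≤ Real.exp (-s d) - 1 + s d := by linarith [Real.add_one_le_exp (-s d)]
    rw [h1]
    refine le_trans ?_ (mul_le_mul_of_nonneg_right h4 h7)
    rw [hc, div_mul_eq_mul_div, div_le_iff₀ (by positivity), mul_assoc]
    refine mul_le_mul_of_nonneg_left ?_ (Real.exp_pos _).le
    linarith
  have hdrop : ∀ d m, c * ∑ k ∈ Finset.range m, s (d + k) ^ 2 ≤
      expDivergence xs (x d) - expDivergence xs (x (d + m)) := by
    intro d m
    induction m with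
    | zero => simp
    | succ m ih =>
      rw [Finset.sum_range_succ, mul_add, ← add_assoc]
      linarith [hstep (d + m)]
  have hsum : Summable S := by
    refine summable_of_sq_le_sub_shift (D := fun d => expDivergence xs (x d)) (J := J)
      (K := C * (Fintype.card κ * Real.exp L₀) + 1) (c := c / J) (by positivity)
      (by positivity) (fun d => expDivergence_nonneg _ _) hS0 (fun d => ?_) (fun d => ?_)
    · refine (hCR xs (x d) hxsL (hxL d) (Submodule.sub_mem _ (hrange d) hxs)
        (Fintype.card κ * Real.exp L₀ * S d) (mul_nonneg (by positivity) (hS0 d))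
        (hres d)).trans ?_
      rw [mul_pow _ (S d), ← mul_assoc, ← mul_pow]
      gcongr
      linarith
    · refine le_trans ?_ (hdrop d J)
      have := sq_sum_le_card_mul_sum_sq (s := Finset.range J) (f := fun k => |s (d + k)|)
      simp only [sq_abs, Finset.card_range] at this
      rw [div_mul_eq_mul_div, div_le_iff₀ (by positivity), mul_assoc]
      refine mul_le_mul_of_nonneg_left ?_ hc0.le
      linarith
  refine Summable.of_nonneg_of_le (fun d => abs_nonneg _) (fun d => ?_) hsum
  exact Finset.single_le_sum (f := fun k => |s (d + k)|) (fun _ _ => abs_nonneg _)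
    (Finset.mem_range.2 hJ)

end CyclicScaling


/-- If the IPF(γ) sequence converges pointwise to a strictly positive
limit `δ*`, then each multiplicative-parameter sequence `θ⁽ᵈ⁾(j)` converges to some
`θ*(j) > 0` and `δ*(i) = ∏_j (θ*(j))^{a_{ji}}`. -/
theorem ipf_model_parameters_converge {J n : ℕ} (hJ : 0 < J)
    (A : Fin J → Fin n → ℝ) (hA : ∀ j i, A j i = 0 ∨ A j i = 1)
    (q : Fin n → ℝ) (hq : ∀ i, 0 < q i) (γ : ℝ) (hγ : 0 < γ)
    (istar : Fin J → Fin n) (histar : ∀ j, A j (istar j) = 1)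
    (δ : ℕ → Fin n → ℝ) (θ : ℕ → Fin J → ℝ)
    (hδ0 : ∀ i, δ 0 i = 1) (hθ0 : ∀ j, θ 0 j = 1)
    (hrecδ : ∀ d i, δ (d + 1) i =
      δ d i * (γ * (∑ k, A ⟨d % J, Nat.mod_lt d hJ⟩ k * q k) /
        (∑ k, A ⟨d % J, Nat.mod_lt d hJ⟩ k * δ d k)) ^ (A ⟨d % J, Nat.mod_lt d hJ⟩ i))
    (hrecθ : ∀ d, θ (d + 1) ⟨d % J, Nat.mod_lt d hJ⟩ =
      θ d ⟨d % J, Nat.mod_lt d hJ⟩ *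
        (δ (d + 1) (istar ⟨d % J, Nat.mod_lt d hJ⟩) /
          δ d (istar ⟨d % J, Nat.mod_lt d hJ⟩)))
    (hrecθ' : ∀ d (l : Fin J), l ≠ ⟨d % J, Nat.mod_lt d hJ⟩ → θ (d + 1) l = θ d l)
    (δs : Fin n → ℝ) (hδspos : ∀ i, 0 < δs i)
    (hconv : ∀ i, Filter.Tendsto (fun d => δ d i) Filter.atTop (nhds (δs i))) :
    ∃ θs : Fin J → ℝ, (∀ j, 0 < θs j) ∧
      (∀ j, Filter.Tendsto (fun d => θ d j) Filter.atTop (nhds (θs j))) ∧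
      (∀ i, δs i = ∏ j, (θs j) ^ (A j i)) := by
  have hAnn : ∀ j i, 0 ≤ A j i := fun j i => by rcases hA j i with h | h <;> simp [h]
  have hrowsum : ∀ j (y : Fin n → ℝ), (∀ i, 0 < y i) → 0 < ∑ k, A j k * y k := fun j y hy =>
    Finset.sum_pos' (fun i _ => mul_nonneg (hAnn j i) (hy i).le)
      ⟨istar j, Finset.mem_univ _, by rw [histar, one_mul]; exact hy _⟩
  set idx : ℕ → Fin J := fun d => ⟨d % J, Nat.mod_lt d hJ⟩
  set t : ℕ → ℝ := fun d => γ * (∑ k, A (idx d) k * q k) / (∑ k, A (idx d) k * δ d k) with ht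
  have hδ : ∀ d i, δ (d + 1) i = δ d i * t d ^ A (idx d) i := hrecδ
  have htpos' : ∀ d, (∀ i, 0 < δ d i) → 0 < t d := fun d hd =>
    div_pos (mul_pos hγ (hrowsum _ _ hq)) (hrowsum _ _ hd)
  have hδpos : ∀ d i, 0 < δ d i := by
    intro d
    induction d with
    | zero => intro i; rw [hδ0]; exact one_pos
    | succ d ih =>
      intro i
      rw [hδ]
      exact mul_pos (ih i) (Real.rpow_pos_of_pos (htpos' d ih) _)
  have htpos : ∀ d, 0 < t d := fun d => htpos' d (hδpos d)
  have hθt : ∀ d, θ (d + 1) (idx d) = θ d (idx d) * t d := by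
    intro d
    have h1 := hrecθ d
    change θ (d + 1) (idx d) = θ d (idx d) *
      (δ (d + 1) (istar (idx d)) / δ d (istar (idx d))) at h1
    rw [h1, hδ, histar, Real.rpow_one, mul_div_cancel_left₀ _ (hδpos _ _).ne']
  have hθpos : ∀ d j, 0 < θ d j := by
    intro d
    induction d with
    | zero => intro j; rw [hθ0]; exact one_pos
    | succ d ih =>
      intro j
      by_cases hj : j = idx d
      · rw [hj, hθt]; exact mul_pos (ih _) (htpos d)
      · rw [hrecθ' d j hj]; exact ih j
  have hlogθ : ∀ d j, Real.log (θ (d + 1) j) =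
      Real.log (θ d j) + if j = idx d then Real.log (t d) else 0 := by
    intro d j
    split_ifs with hj
    · rw [hj, hθt, Real.log_mul (hθpos _ _).ne' (htpos d).ne']
    · rw [hrecθ' d j hj, add_zero]
  have hx : ∀ d i, Real.log (δ (d + 1) i) =
      Real.log (δ d i) + A (idx d) i * Real.log (t d) := by
    intro d i
    rw [hδ, Real.log_mul (hδpos _ _).ne' (Real.rpow_pos_of_pos (htpos d) _).ne',
      Real.log_rpow (htpos d)]
  have hmodel : ∀ d i, Real.log (δ d i) = ∑ j, Real.log (θ d j) * A j i := by
    intro d i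
    induction d with
    | zero => simp [hδ0, hθ0]
    | succ d ih =>
      simp_rw [hx, hlogθ, add_mul, Finset.sum_add_distrib, ih, ite_mul, zero_mul]
      rw [Finset.sum_ite_eq' Finset.univ (idx d), if_pos (Finset.mem_univ _), mul_comm (A _ _)]
  have hfitq : ∀ d, ∑ k, A (idx d) k * δ (d + 1) k = γ * ∑ k, A (idx d) k * q k := by
    intro d
    have h1 : ∀ k, A (idx d) k * δ (d + 1) k = A (idx d) k * δ d k * t d := by
      intro k
      rw [hδ]
      rcases hA (idx d) k with h | h <;> simp [h]
    simp_rw [h1]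
    rw [← Finset.sum_mul, ht, mul_div_cancel₀ _ (hrowsum _ _ (hδpos d)).ne']
  have hidx : ∀ d j, ∃ k < J, idx (d + k) = j := by
    intro d j
    refine ⟨(j + (J - d % J)) % J, Nat.mod_lt _ hJ, Fin.ext ?_⟩
    have h1 : d % J < J := Nat.mod_lt d hJ
    change (d + (j + (J - d % J)) % J) % J = j
    rw [Nat.add_mod_mod, Nat.add_mod, Nat.add_mod_mod,
      show d % J + (j + (J - d % J)) = j + J by omega, Nat.add_mod_right, Nat.mod_eq_of_lt j.2]
  have hfits : ∀ j, ∑ k, A j k * δs k = γ * ∑ k, A j k * q k := by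
    intro j
    have h1 : Tendsto (fun d => ∑ k, A j k * δ d k) atTop (𝓝 (∑ k, A j k * δs k)) :=
      tendsto_finsetSum _ fun k _ => (hconv k).const_mul _
    refine tendsto_nhds_unique_of_frequently_eq h1 tendsto_const_nhds ?_
    rw [frequently_atTop]
    intro d
    obtain ⟨k, -, rfl⟩ := hidx d j
    exact ⟨d + k + 1, by omega, hfitq _⟩
  have hlim : Tendsto (fun d i => Real.log (δ d i)) atTop (𝓝 fun i => Real.log (δs i)) :=
    tendsto_pi_nhds.2 fun i => (hconv i).log (hδspos i).ne'
  have hsum : Summable fun d => |Real.log (t d)| := by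
    refine summable_abs_step_of_cyclic (J := J) hA (fun j => ⟨istar j, histar j⟩) hx
      (fun d => ⟨fun j => Real.log (θ d j), funext fun i => (hmodel d i).symm⟩) hlim
      (fun d => ?_) hidx
    simp_rw [Real.exp_log (hδpos _ _), Real.exp_log (hδspos _)]
    rw [hfitq, hfits]
  have hcauchy : ∀ j, ∃ u, Tendsto (fun d => Real.log (θ d j)) atTop (𝓝 u) := by
    intro j
    refine cauchySeq_tendsto_of_complete (cauchySeq_of_summable_dist ?_)
    refine Summable.of_nonneg_of_le (fun _ => dist_nonneg) (fun d => ?_) hsum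
    rw [dist_comm, Real.dist_eq, hlogθ, add_sub_cancel_left]
    split_ifs <;> simp
  choose u hu using hcauchy
  have hθlim : ∀ j, Tendsto (fun d => θ d j) atTop (𝓝 (Real.exp (u j))) := fun j =>
    ((Real.continuous_exp.tendsto _).comp (hu j)).congr fun d => Real.exp_log (hθpos d j)
  refine ⟨fun j => Real.exp (u j), fun j => Real.exp_pos _, hθlim, fun i => ?_⟩
  have h1 : Real.log (δs i) = ∑ j, u j * A j i := by
    refine tendsto_nhds_unique (tendsto_pi_nhds.1 hlim i) ?_
    simp_rw [hmodel]
    exact tendsto_finsetSum _ fun j _ => (hu j).mul_const _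
  rw [← Real.exp_log (hδspos i), h1, Real.exp_sum]
  exact Finset.prod_congr rfl fun j _ => Real.exp_mul _ _
end

section
/- Let A be a J×n matrix with entries in {0,1} such that every column of A contains at least one 1 and every row is nonzero, and let q ∈ ℝⁿ have strictly positive entries with Σ_i q(i) = 1. Assume that for every γ > 0 the system A δ = γ·A q, D log δ = 0 has a unique strictly positive solution δ_γ ∈ ℝⁿ. Then the map γ ↦ δ_γ is continuous on (0, ∞), and consequently γ ↦ Σ_i δ_γ(i) is continuous on (0, ∞). -/
/-- On `(0, M]` the logarithm is strongly monotone with constant `1 / M`. -/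
theorem sq_sub_le_mul_sub_mul_log_sub {a b M : ℝ} (ha : 0 < a) (hb : 0 < b)
    (haM : a ≤ M) (hbM : b ≤ M) :
    (a - b) ^ 2 ≤ M * ((a - b) * (Real.log a - Real.log b)) := by
  wlog hab : b ≤ a generalizing a b
  · have := this hb ha hbM haM (le_of_not_ge hab)
    nlinarith
  have hlog : a - b ≤ a * (Real.log a - Real.log b) := by
    have h := Real.one_sub_inv_le_log_of_pos (div_pos ha hb)
    rw [Real.log_div ha.ne' hb.ne', inv_div] at h
    calc a - b = a * (1 - b / a) := by field_simp
      _ ≤ _ := mul_le_mul_of_nonneg_left h ha.le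
  have hmono : 0 ≤ Real.log a - Real.log b := sub_nonneg.2 (Real.log_le_log hb hab)
  have hM : a * (Real.log a - Real.log b) ≤ M * (Real.log a - Real.log b) :=
    mul_le_mul_of_nonneg_right haM hmono
  nlinarith [mul_le_mul_of_nonneg_left (hlog.trans hM) (sub_nonneg.2 hab)]

/-- If `x` is orthogonal to a family, it is orthogonal to its span. -/
theorem sum_mul_eq_zero_of_mem_span_s8 {ι κ : Type*} [Fintype ι] {D : κ → ι → ℝ} {x y : ι → ℝ}
    (hx : ∀ k, ∑ i, D k i * x i = 0) (hy : y ∈ Submodule.span ℝ (Set.range D)) :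
    ∑ i, y i * x i = 0 := by
  induction hy using Submodule.span_induction with
  | mem y hy =>
    obtain ⟨k, rfl⟩ := hy
    exact hx k
  | zero => simp
  | add y z _ _ hy hz => simp [add_mul, Finset.sum_add_distrib, hy, hz]
  | smul c y _ hy => simp [mul_assoc, ← Finset.mul_sum, hy]

/-- If `log u` and `log v` are orthogonal to `u - s v`, and `u` and `s v` have entries in
`(0, M]`, then `u` is close to `s v` when `s` is close to `1`. -/
theorem sq_sub_mul_le_of_log_orthogonal {ι : Type*} [Fintype ι] {u v : ι → ℝ} {s M : ℝ}
    (hs : 0 < s) (hu : ∀ i, 0 < u i) (hv : ∀ i, 0 < v i)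
    (huM : ∀ i, u i ≤ M) (hvM : ∀ i, s * v i ≤ M)
    (hulog : ∑ i, (u i - s * v i) * Real.log (u i) = 0)
    (hvlog : ∑ i, (u i - s * v i) * Real.log (v i) = 0) (i : ι) :
    (u i - s * v i) ^ 2 ≤ M * (|Real.log s| * (Fintype.card ι * M)) := by
  have hM : 0 ≤ M := (hu i).le.trans (huM i)
  have hsv : ∀ i, 0 < s * v i := fun i => mul_pos hs (hv i)
  have hsum : ∑ i, (u i - s * v i) * (Real.log (u i) - Real.log (s * v i)) =
      ∑ i, -Real.log s * (u i - s * v i) := by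
    have hterm : ∀ i, (u i - s * v i) * (Real.log (u i) - Real.log (s * v i)) =
        (u i - s * v i) * Real.log (u i) - (u i - s * v i) * Real.log (v i) +
          -Real.log s * (u i - s * v i) := fun i => by
      rw [Real.log_mul hs.ne' (hv i).ne']
      ring
    simp only [hterm, Finset.sum_add_distrib, Finset.sum_sub_distrib, hulog, hvlog]
    ring
  have hbound : ∑ i, -Real.log s * (u i - s * v i) ≤ |Real.log s| * (Fintype.card ι * M) := by
    have : ∀ i ∈ Finset.univ, -Real.log s * (u i - s * v i) ≤ |Real.log s| * M := by
      intro i _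
      refine (le_abs_self _).trans ?_
      rw [abs_mul, abs_neg]
      refine mul_le_mul_of_nonneg_left (abs_le.2 ⟨?_, ?_⟩) (abs_nonneg _)
      · linarith [hu i, hvM i]
      · linarith [hsv i, huM i]
    refine (Finset.sum_le_card_nsmul _ _ _ this).trans (le_of_eq ?_)
    rw [nsmul_eq_mul, Finset.card_univ]
    ring
  have hnonneg : ∀ i ∈ Finset.univ,
      0 ≤ (u i - s * v i) * (Real.log (u i) - Real.log (s * v i)) := by
    intro i _
    rcases le_total (u i) (s * v i) with h | h
    · exact mul_nonneg_of_nonpos_of_nonpos (sub_nonpos.2 h)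
        (sub_nonpos.2 (Real.log_le_log (hu i) h))
    · exact mul_nonneg (sub_nonneg.2 h) (sub_nonneg.2 (Real.log_le_log (hsv i) h))
  calc (u i - s * v i) ^ 2
      ≤ M * ((u i - s * v i) * (Real.log (u i) - Real.log (s * v i))) :=
        sq_sub_le_mul_sub_mul_log_sub (hu i) (hsv i) (huM i) (hvM i)
    _ ≤ M * (|Real.log s| * (Fintype.card ι * M)) :=
        mul_le_mul_of_nonneg_left
          (((Finset.single_le_sum hnonneg (Finset.mem_univ i)).trans_eq hsum).trans hbound) hM


/-- If for every `γ > 0` the system `A δ = γ·A q`, `D log δ = 0` has a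
unique strictly positive solution `δ_γ`, then `γ ↦ δ_γ` is continuous on `(0, ∞)`, and so
is `γ ↦ Σ_i δ_γ(i)`. -/
theorem solution_continuous_in_gamma {J n m : ℕ} (hJ : 0 < J)
    (A : Fin J → Fin n → ℝ) (hA : ∀ j i, A j i = 0 ∨ A j i = 1)
    (hcol : ∀ i, ∃ j, A j i = 1)
    (hrows : ∀ j, ∃ i, A j i = 1)
    (q : Fin n → ℝ) (hq : ∀ i, 0 < q i) (hq1 : ∑ i, q i = 1)
    -- `D` is a kernel basis matrix of `A`
    (D : Fin m → Fin n → ℝ)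
    (hDker : ∀ k j, ∑ i, A j i * D k i = 0)
    (hDind : LinearIndependent ℝ D)
    (hDspan : ∀ x : Fin n → ℝ, (∀ j, ∑ i, A j i * x i = 0) →
      x ∈ Submodule.span ℝ (Set.range D))
    -- `δfun γ` is the unique strictly positive solution of the system, for every `γ > 0`
    (δfun : ℝ → Fin n → ℝ)
    (hsol : ∀ γ : ℝ, 0 < γ →
      (∀ i, 0 < δfun γ i) ∧
      (∀ j, ∑ i, A j i * δfun γ i = γ * ∑ i, A j i * q i) ∧
      (∀ k, ∑ i, D k i * Real.log (δfun γ i) = 0))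
    (huniq : ∀ γ : ℝ, 0 < γ → ∀ δ : Fin n → ℝ, (∀ i, 0 < δ i) →
      (∀ j, ∑ i, A j i * δ i = γ * ∑ i, A j i * q i) →
      (∀ k, ∑ i, D k i * Real.log (δ i) = 0) → δ = δfun γ) :
    ContinuousOn δfun (Set.Ioi 0) ∧
      ContinuousOn (fun γ => ∑ i, δfun γ i) (Set.Ioi 0) := by
  have hle : ∀ γ : ℝ, 0 < γ → ∀ i, δfun γ i ≤ γ := by
    intro γ hγ i
    obtain ⟨hpos, hAδ, -⟩ := hsol γ hγ
    obtain ⟨j, hj⟩ := hcol i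
    have hA0 : ∀ i, 0 ≤ A j i := fun i => by rcases hA j i with h | h <;> simp [h]
    have hA1 : ∀ i, A j i ≤ 1 := fun i => by rcases hA j i with h | h <;> simp [h]
    calc δfun γ i = A j i * δfun γ i := by rw [hj, one_mul]
      _ ≤ ∑ i, A j i * δfun γ i :=
        Finset.single_le_sum (f := fun i => A j i * δfun γ i)
          (fun i _ => mul_nonneg (hA0 i) (hpos i).le) (Finset.mem_univ i)
      _ = γ * ∑ i, A j i * q i := hAδ j
      _ ≤ γ * ∑ i, q i := mul_le_mul_of_nonneg_left
        (Finset.sum_le_sum fun i _ => mul_le_of_le_one_left (hq i).le (hA1 i)) hγ.le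
      _ = γ := by rw [hq1, mul_one]
  have hest : ∀ γ₀ : ℝ, 0 < γ₀ → ∀ γ : ℝ, 0 < γ → ∀ i,
      (δfun γ i - γ / γ₀ * δfun γ₀ i) ^ 2 ≤ γ * (|Real.log (γ / γ₀)| * (n * γ)) := by
    intro γ₀ hγ₀ γ hγ i
    obtain ⟨hu, hAu, hDu⟩ := hsol γ hγ
    obtain ⟨hv, hAv, hDv⟩ := hsol γ₀ hγ₀
    have hs : 0 < γ / γ₀ := div_pos hγ hγ₀
    have hmem : (fun i => δfun γ i - γ / γ₀ * δfun γ₀ i) ∈ Submodule.span ℝ (Set.range D) := by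
      refine hDspan _ fun j => ?_
      simp only [mul_sub, Finset.sum_sub_distrib, mul_left_comm _ (γ / γ₀), ← Finset.mul_sum,
        hAu, hAv]
      field_simp
      ring
    have h := sq_sub_mul_le_of_log_orthogonal hs hu hv (hle γ hγ)
      (fun i => (mul_le_mul_of_nonneg_left (hle γ₀ hγ₀ i) hs.le).trans_eq
        (div_mul_cancel₀ γ hγ₀.ne'))
      (sum_mul_eq_zero_of_mem_span_s8 hDu hmem) (sum_mul_eq_zero_of_mem_span_s8 hDv hmem) i
    rwa [Fintype.card_fin] at h
  have hcont : ∀ i, ContinuousOn (fun γ => δfun γ i) (Set.Ioi 0) := by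
    intro i γ₀ (hγ₀ : 0 < γ₀)
    have hdiff : Filter.Tendsto (fun γ => δfun γ i - γ / γ₀ * δfun γ₀ i)
        (nhdsWithin γ₀ (Set.Ioi 0)) (nhds 0) := by
      have hbound : Filter.Tendsto (fun γ => √(γ * (|Real.log (γ / γ₀)| * (n * γ))))
          (nhdsWithin γ₀ (Set.Ioi 0)) (nhds 0) := by
        have hc : ContinuousAt (fun γ => √(γ * (|Real.log (γ / γ₀)| * (n * γ)))) γ₀ := by
          have : γ₀ / γ₀ ≠ 0 := by simp [hγ₀.ne']
          fun_prop (disch := assumption)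
        have h := hc.tendsto
        rw [div_self hγ₀.ne', Real.log_one, abs_zero, zero_mul, mul_zero, Real.sqrt_zero] at h
        exact h.mono_left nhdsWithin_le_nhds
      refine squeeze_zero_norm' ?_ hbound
      filter_upwards [self_mem_nhdsWithin] with γ hγ
      exact Real.abs_le_sqrt (hest γ₀ hγ₀ γ hγ i)
    have hlin : Filter.Tendsto (fun γ => γ / γ₀ * δfun γ₀ i)
        (nhdsWithin γ₀ (Set.Ioi 0)) (nhds (δfun γ₀ i)) := by
      have hc : Continuous fun γ => γ / γ₀ * δfun γ₀ i := by fun_prop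
      have h := hc.tendsto γ₀
      rw [div_self hγ₀.ne', one_mul] at h
      exact h.mono_left nhdsWithin_le_nhds
    simpa [ContinuousWithinAt] using hdiff.add hlin
  exact ⟨continuousOn_pi.2 hcont, continuousOn_finsetSum _ fun i _ => hcont i⟩
end

section
/- Let A be a J×n matrix with entries in {0,1} such that every column of A contains at least one 1 and every row is nonzero, and let q ∈ ℝⁿ have strictly positive entries with Σ_i q(i) = 1. Assume that for every γ > 0 the system A δ = γ·A q, D log δ = 0 has a unique strictly positive solution δ_γ ∈ ℝⁿ, and that γ ↦ δ_γ is continuous. Set γ_L = (Σ_{j=1}^{J} A_j·q)⁻¹ and γ_R = min{1/(A_1·q), …, 1/(A_J·q)}. Then there exists γ* ∈ [γ_L, γ_R] such that Σ_i δ_{γ*}(i) = 1. -/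
/-- Under the hypotheses of Statement 8 (unique strictly positive solution
`δ_γ` for every `γ > 0`, depending continuously on `γ`), with `γ_L = (Σ_j A_j·q)⁻¹` and
`γ_R = min_j 1/(A_j·q)`, there exists `γ* ∈ [γ_L, γ_R]` with `Σ_i δ_{γ*}(i) = 1`. -/
theorem exists_gamma_star {J n m : ℕ} (hJ : 0 < J)
    (A : Fin J → Fin n → ℝ) (hA : ∀ j i, A j i = 0 ∨ A j i = 1)
    (hcol : ∀ i, ∃ j, A j i = 1)
    (hrows : ∀ j, ∃ i, A j i = 1)
    (q : Fin n → ℝ) (hq : ∀ i, 0 < q i) (hq1 : ∑ i, q i = 1)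
    -- `D` is a kernel basis matrix of `A`
    (D : Fin m → Fin n → ℝ)
    (hDker : ∀ k j, ∑ i, A j i * D k i = 0)
    (hDind : LinearIndependent ℝ D)
    (hDspan : ∀ x : Fin n → ℝ, (∀ j, ∑ i, A j i * x i = 0) →
      x ∈ Submodule.span ℝ (Set.range D))
    -- `δfun γ` is the unique strictly positive solution of the system, for every `γ > 0`
    (δfun : ℝ → Fin n → ℝ)
    (hsol : ∀ γ : ℝ, 0 < γ →
      (∀ i, 0 < δfun γ i) ∧
      (∀ j, ∑ i, A j i * δfun γ i = γ * ∑ i, A j i * q i) ∧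
      (∀ k, ∑ i, D k i * Real.log (δfun γ i) = 0))
    (huniq : ∀ γ : ℝ, 0 < γ → ∀ δ : Fin n → ℝ, (∀ i, 0 < δ i) →
      (∀ j, ∑ i, A j i * δ i = γ * ∑ i, A j i * q i) →
      (∀ k, ∑ i, D k i * Real.log (δ i) = 0) → δ = δfun γ)
    (hcont : ContinuousOn δfun (Set.Ioi 0))
    (γL γR : ℝ)
    (hγL : γL = (∑ j, ∑ i, A j i * q i)⁻¹)
    (hγR : γR = Finset.univ.inf'
      (Finset.univ_nonempty_iff.mpr (Fin.pos_iff_nonempty.mp hJ))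
      (fun j => (∑ i, A j i * q i)⁻¹)) :
    ∃ γs ∈ Set.Icc γL γR, ∑ i, δfun γs i = 1 := by
  have hA0 : ∀ j i, 0 ≤ A j i := fun j i => by
    rcases hA j i with h | h <;> simp [h]
  have hA1 : ∀ j i, A j i ≤ 1 := fun j i => by
    rcases hA j i with h | h <;> simp [h]
  have hrow : ∀ j, 0 < ∑ i, A j i * q i := fun j => by
    obtain ⟨i, hi⟩ := hrows j
    exact Finset.sum_pos' (fun i _ => mul_nonneg (hA0 j i) (hq i).le)
      ⟨i, Finset.mem_univ i, by simpa [hi] using hq i⟩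
  obtain ⟨j₀, -, hj₀⟩ := Finset.exists_mem_eq_inf'
    (Finset.univ_nonempty_iff.mpr (Fin.pos_iff_nonempty.mp hJ))
    (fun j => (∑ i, A j i * q i)⁻¹)
  rw [hj₀] at hγR
  have hle : ∑ i, A j₀ i * q i ≤ ∑ j, ∑ i, A j i * q i :=
    Finset.single_le_sum (f := fun j => ∑ i, A j i * q i) (fun j _ => (hrow j).le)
      (Finset.mem_univ j₀)
  have htot : 0 < ∑ j, ∑ i, A j i * q i := (hrow j₀).trans_le hle
  have hL : 0 < γL := hγL ▸ inv_pos.mpr htot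
  have hR : 0 < γR := hγR ▸ inv_pos.mpr (hrow j₀)
  have hLR : γL ≤ γR := by
    rw [hγL, hγR]
    exact inv_anti₀ (hrow j₀) hle
  have hsumL : ∑ i, δfun γL i ≤ 1 := by
    obtain ⟨hpos, hsys, -⟩ := hsol γL hL
    calc ∑ i, δfun γL i ≤ ∑ i, ∑ j, A j i * δfun γL i := by
          refine Finset.sum_le_sum fun i _ => ?_
          obtain ⟨j, hj⟩ := hcol i
          calc δfun γL i = A j i * δfun γL i := by rw [hj, one_mul]
            _ ≤ ∑ j, A j i * δfun γL i :=
              Finset.single_le_sum (f := fun j => A j i * δfun γL i)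
                (fun j _ => mul_nonneg (hA0 j i) (hpos i).le) (Finset.mem_univ j)
      _ = γL * ∑ j, ∑ i, A j i * q i := by
          rw [Finset.sum_comm, Finset.mul_sum]
          exact Finset.sum_congr rfl fun j _ => hsys j
      _ = 1 := by rw [hγL, inv_mul_cancel₀ htot.ne']
  have hsumR : 1 ≤ ∑ i, δfun γR i := by
    obtain ⟨hpos, hsys, -⟩ := hsol γR hR
    calc (1 : ℝ) = ∑ i, A j₀ i * δfun γR i := by
          rw [hsys j₀, hγR, inv_mul_cancel₀ (hrow j₀).ne']
      _ ≤ ∑ i, δfun γR i :=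
          Finset.sum_le_sum fun i _ => mul_le_of_le_one_left (hpos i).le (hA1 j₀ i)
  have hc : ContinuousOn (fun γ => ∑ i, δfun γ i) (Set.Icc γL γR) :=
    continuousOn_finsetSum _ fun i _ =>
      (continuousOn_pi.mp hcont i).mono fun γ hγ => hL.trans_le hγ.1
  exact intermediate_value_Icc hLR hc ⟨hsumL, hsumR⟩
end

section
/- Let A be a J×n real matrix such that the all-ones vector 1 does not belong to the row space of A, and let m = dim ker A ≥ 1, where ker A = {x ∈ ℝⁿ : A x = 0}. Then ker A admits a basis d_1, …, d_m such that Σ_i d_1(i) ≠ 0 and Σ_i d_k(i) = 0 for every k = 2, …, m. (In the language of relational models: a model without the overall effect has a dual representation with exactly one non-homogeneous generalized odds ratio.) -/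
/-- A linear functional that does not vanish identically on a finite-dimensional space admits
a basis in which exactly the first vector lies outside its kernel. -/
theorem exists_basis_fin_succ_apply_zero_ne {K V : Type*} [Field K] [AddCommGroup V] [Module K V]
    [FiniteDimensional K V] (f : Module.Dual K V) (hf : f ≠ 0) {m : ℕ}
    (hm : Module.finrank K V = m + 1) :
    ∃ b : Module.Basis (Fin (m + 1)) K V, f (b 0) ≠ 0 ∧ ∀ k : Fin m, f (b k.succ) = 0 := by
  obtain ⟨x, hx⟩ : ∃ x, f x ≠ 0 := by
    by_contra! h
    exact hf (LinearMap.ext h)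
  have hker : Module.finrank K (LinearMap.ker f) = m := by
    have := Module.Dual.finrank_ker_add_one_of_ne_zero hf
    omega
  let c := Module.finBasisOfFinrankEq K (LinearMap.ker f) hker
  let v : Fin m → V := fun k => c k
  have hv : ∀ k, f (v k) = 0 := fun k => (c k).2
  have hli : LinearIndependent K v :=
    c.linearIndependent.map' (LinearMap.ker f).subtype (Submodule.ker_subtype _)
  have hspan : Submodule.span K (Set.range v) ≤ LinearMap.ker f :=
    Submodule.span_le.2 (Set.range_subset_iff.2 hv)
  have hli' : LinearIndependent K (Fin.cons x v : Fin (m + 1) → V) :=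
    linearIndependent_finCons.2 ⟨hli, fun h => hx (hspan h)⟩
  refine ⟨basisOfLinearIndependentOfCardEqFinrank hli' (by simp [hm]), ?_, fun k => ?_⟩
  · simpa using hx
  · simpa using hv k

/-- A vector orthogonal to every vector in the joint kernel of the rows of `A` lies in the row
space of `A`. -/
theorem mem_span_range_of_forall_dotProduct_eq_zero {K ι κ : Type*} [Field K] [Finite ι]
    [Fintype κ] (A : ι → κ → K) (u : κ → K)
    (h : ∀ x : κ → K, (∀ j, A j ⬝ᵥ x = 0) → u ⬝ᵥ x = 0) :
    u ∈ Submodule.span K (Set.range A) := by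
  classical
  let e : (κ → K) ≃ₗ[K] Module.Dual K (κ → K) := dotProductEquiv K κ
  have hmem : e u ∈ Submodule.span K (Set.range fun j => e (A j)) := by
    refine mem_span_of_iInf_ker_le_ker fun x hx => ?_
    simp only [Submodule.mem_iInf, LinearMap.mem_ker] at hx ⊢
    exact h x hx
  rw [Set.range_comp' e A, ← LinearEquiv.coe_coe, Submodule.span_image] at hmem
  obtain ⟨w, hw, hwu⟩ := hmem
  exact e.injective hwu ▸ hw

/-- If the all-ones vector is not in the row space of `A` and
`m = dim ker A ≥ 1`, then `ker A` has a basis `d_1, …, d_m` in which exactly the first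
vector has nonzero coordinate sum (one non-homogeneous generalized odds ratio). -/
theorem kernel_basis_with_one_nonhomogeneous_row {J n m : ℕ}
    (A : Fin J → Fin n → ℝ)
    (h1 : (fun _ : Fin n => (1 : ℝ)) ∉ Submodule.span ℝ (Set.range A))
    (hm : Module.finrank ℝ (LinearMap.ker (Matrix.mulVecLin (Matrix.of A))) = m)
    (hm1 : 0 < m) :
    ∃ d : Fin m → Fin n → ℝ,
      LinearIndependent ℝ d ∧
      (∀ k j, ∑ i, A j i * d k i = 0) ∧
      (∀ x : Fin n → ℝ, (∀ j, ∑ i, A j i * x i = 0) →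
        x ∈ Submodule.span ℝ (Set.range d)) ∧
      (∑ i, d ⟨0, hm1⟩ i ≠ 0) ∧
      (∀ k : Fin m, k ≠ ⟨0, hm1⟩ → ∑ i, d k i = 0) := by
  have hmem : ∀ x : Fin n → ℝ, x ∈ LinearMap.ker (Matrix.mulVecLin (Matrix.of A)) ↔
      ∀ j, ∑ i, A j i * x i = 0 := fun x => by
    simp [funext_iff, Matrix.mulVec, dotProduct]
  obtain ⟨m, rfl⟩ := Nat.exists_eq_succ_of_ne_zero hm1.ne'
  let f : Module.Dual ℝ (LinearMap.ker (Matrix.mulVecLin (Matrix.of A))) :=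
    (∑ i, LinearMap.proj i : (Fin n → ℝ) →ₗ[ℝ] ℝ) ∘ₗ Submodule.subtype _
  have hfa : ∀ x, f x = ∑ i, x.1 i := fun x => by simp [f]
  have hf : f ≠ 0 := fun h => h1 <| mem_span_range_of_forall_dotProduct_eq_zero A _ fun x hx => by
    simpa [h, dotProduct] using (hfa ⟨x, (hmem x).2 hx⟩).symm
  obtain ⟨b, hb0, hb⟩ := exists_basis_fin_succ_apply_zero_ne f hf hm
  refine ⟨fun k => b k, b.linearIndependent.map' (Submodule.subtype _) (Submodule.ker_subtype _),
    fun k => (hmem _).1 (b k).2, fun x hx => ?_, ?_, fun k hk => ?_⟩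
  · have h := Submodule.mem_map_of_mem (f := Submodule.subtype _)
      (b.mem_span ⟨x, (hmem x).2 hx⟩)
    rwa [Submodule.map_span, ← Set.range_comp] at h
  · rw [← hfa]
    exact hb0
  · obtain ⟨j, rfl⟩ := Fin.exists_succ_eq.2 hk
    rw [← hfa]
    exact hb j
end

section
/- Let A be a J×n matrix with entries in {0,1} such that the all-ones vector 1 does not belong to the row space of A, and let D be a kernel basis matrix of A. If δ ∈ ℝⁿ has strictly positive entries and satisfies D log δ = 0, then for every t > 0 with t ≠ 1 the rescaled vector t·δ satisfies D log(t·δ) ≠ 0. (A relational model without the overall effect is not scale invariant.) -/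
/-- A vector outside the row space of a matrix fails to be annihilated by some vector of
the kernel of that matrix. -/
theorem exists_kernel_vector_of_notMem_span {K ι κ : Type*} [Field K] [Fintype ι]
    {A : κ → ι → K} {v : ι → K} (hv : v ∉ Submodule.span K (Set.range A)) :
    ∃ x : ι → K, (∀ j, ∑ i, A j i * x i = 0) ∧ ∑ i, v i * x i ≠ 0 := by
  classical
  obtain ⟨f, hfv, hf⟩ := Submodule.exists_le_ker_of_notMem hv
  have hsum : ∀ y : ι → K, f y = ∑ i, y i * f (fun j => if i = j then 1 else 0) := fun y => by
    simpa using LinearMap.pi_apply_eq_sum_univ f y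
  refine ⟨fun i => f (fun j => if i = j then 1 else 0), fun j => ?_, ?_⟩
  · rw [← hsum]
    exact hf (Submodule.subset_span ⟨j, rfl⟩)
  · rwa [← hsum]

/-- A relational model without the overall effect is not scale invariant:
if `1 ∉ rowspace A`, `D` is a kernel basis matrix of `A`, and the positive vector `δ`
satisfies `D log δ = 0`, then for every `t > 0`, `t ≠ 1`, the vector `t·δ` violates
`D log (t·δ) = 0`. -/
theorem no_overall_effect_not_scale_invariant {J n m : ℕ}
    (A : Fin J → Fin n → ℝ) (hA : ∀ j i, A j i = 0 ∨ A j i = 1)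
    (h1 : (fun _ : Fin n => (1 : ℝ)) ∉ Submodule.span ℝ (Set.range A))
    -- `D` is a kernel basis matrix of `A`
    (D : Fin m → Fin n → ℝ)
    (hDker : ∀ k j, ∑ i, A j i * D k i = 0)
    (hDind : LinearIndependent ℝ D)
    (hDspan : ∀ x : Fin n → ℝ, (∀ j, ∑ i, A j i * x i = 0) →
      x ∈ Submodule.span ℝ (Set.range D))
    (δ : Fin n → ℝ) (hδ : ∀ i, 0 < δ i)
    (hδD : ∀ k, ∑ i, D k i * Real.log (δ i) = 0) :
    ∀ t : ℝ, 0 < t → t ≠ 1 →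
      ∃ k, ∑ i, D k i * Real.log (t * δ i) ≠ 0 := by
  intro t ht ht1
  by_contra! hD
  have hlog : Real.log t ≠ 0 := Real.log_ne_zero_of_pos_of_ne_one ht ht1
  have hDsum : ∀ k, ∑ i, D k i = 0 := fun k => by
    have h := hD k
    simp only [Real.log_mul ht.ne' (hδ _).ne', mul_add, Finset.sum_add_distrib, hδD,
      add_zero, ← Finset.sum_mul] at h
    exact (mul_eq_zero.mp h).resolve_right hlog
  obtain ⟨x, hxA, hx⟩ := exists_kernel_vector_of_notMem_span h1
  refine hx ?_
  simp only [one_mul]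
  refine Submodule.span_induction (p := fun y _ => ∑ i, y i = 0) ?_ ?_ ?_ ?_ (hDspan x hxA)
  · rintro _ ⟨k, rfl⟩
    exact hDsum k
  · simp
  · intro y z _ _ hy hz
    simp [Finset.sum_add_distrib, hy, hz]
  · intro a y _ hy
    simp [← Finset.mul_sum, hy]
end

section
/- Let A be a J×n matrix with entries in {0,1} with nonzero rows, let y ∈ ℝⁿ have nonnegative entries, and suppose λ̂ ∈ ℝⁿ has strictly positive entries, log λ̂ ∈ rowspace(A), and A λ̂ = A y. Then λ̂ maximizes the Poisson log-likelihood ℓ(λ) = Σ_i y(i) log λ(i) − Σ_i λ(i) over the set {λ ∈ ℝⁿ : λ(i) > 0 for all i, log λ ∈ rowspace(A)}; that is, ℓ(λ) ≤ ℓ(λ̂) for every λ in this set. -/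
/-- Linear functionals that agree on the rows of a matrix agree on its row space. -/
theorem sum_mul_eq_of_mem_span_range {ι κ R : Type*} [Fintype κ] [CommSemiring R]
    {A : ι → κ → R} {x y : κ → R} (h : ∀ j, ∑ i, A j i * x i = ∑ i, A j i * y i)
    {v : κ → R} (hv : v ∈ Submodule.span R (Set.range A)) :
    ∑ i, v i * x i = ∑ i, v i * y i := by
  induction hv using Submodule.span_induction with
  | mem v hv =>
    obtain ⟨j, rfl⟩ := hv
    exact h j
  | zero => simp
  | add u v _ _ hu hv => simp only [Pi.add_apply, add_mul, Finset.sum_add_distrib, hu, hv]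
  | smul c v _ hv =>
    simp only [Pi.smul_apply, smul_eq_mul, mul_assoc, ← Finset.mul_sum, hv]

/-- The tangent-line bound for the logarithm at a positive point `b`. -/
theorem mul_log_sub_log_le_sub {a b : ℝ} (ha : 0 < a) (hb : 0 < b) :
    (Real.log a - Real.log b) * b ≤ a - b := by
  rw [← Real.log_div ha.ne' hb.ne']
  calc Real.log (a / b) * b ≤ (a / b - 1) * b := by
        gcongr
        exact Real.log_le_sub_one_of_pos (by positivity)
    _ = a - b := by field_simp

/-- If `λ̂` is strictly positive, lies in the relational model for
intensities (`log λ̂ ∈ rowspace A`), and reproduces the subset sums of the observations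
(`A λ̂ = A y`), then `λ̂` maximizes the Poisson log-likelihood
`ℓ(λ) = Σ_i y(i) log λ(i) − Σ_i λ(i)` over the model. -/
theorem poisson_mle_characterization {J n : ℕ}
    (A : Fin J → Fin n → ℝ) (hA : ∀ j i, A j i = 0 ∨ A j i = 1)
    (hrows : ∀ j, ∃ i, A j i = 1)
    (y : Fin n → ℝ) (hy : ∀ i, 0 ≤ y i)
    (lamhat : Fin n → ℝ) (hpos : ∀ i, 0 < lamhat i)
    (hmodel : (fun i => Real.log (lamhat i)) ∈ Submodule.span ℝ (Set.range A))
    (hfit : ∀ j, ∑ i, A j i * lamhat i = ∑ i, A j i * y i) :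
    ∀ lam : Fin n → ℝ, (∀ i, 0 < lam i) →
      (fun i => Real.log (lam i)) ∈ Submodule.span ℝ (Set.range A) →
      ∑ i, y i * Real.log (lam i) - ∑ i, lam i ≤
        ∑ i, y i * Real.log (lamhat i) - ∑ i, lamhat i := by
  intro lam hlam hmem
  have horth := sum_mul_eq_of_mem_span_range hfit (Submodule.sub_mem _ hmem hmodel)
  have hle := Finset.sum_le_sum fun i (_ : i ∈ Finset.univ) =>
    mul_log_sub_log_le_sub (hlam i) (hpos i)
  simp only [Pi.sub_apply] at horth
  rw [horth] at hle
  simp only [sub_mul, Finset.sum_sub_distrib] at hle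
  simp only [mul_comm (y _)]
  linarith
end

section
/- Let A be a J×n matrix with entries in {0,1} with nonzero rows such that the all-ones vector 1 belongs to rowspace(A), and let q ∈ ℝⁿ have nonnegative entries with Σ_i q(i) = 1. Suppose p̂ ∈ ℝⁿ has strictly positive entries, Σ_i p̂(i) = 1, log p̂ ∈ rowspace(A), and A p̂ = A q. Then p̂ maximizes the multinomial log-likelihood ℓ(p) = Σ_i q(i) log p(i) over the set {p ∈ ℝⁿ : p(i) > 0 for all i, Σ_i p(i) = 1, log p ∈ rowspace(A)}; that is, ℓ(p) ≤ ℓ(p̂) for every p in this set. -/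
/-- **Gibbs' inequality** for positive vectors of equal total mass. -/
theorem sum_log_mul_le_sum_log_mul_self {κ : Type*} [Fintype κ] {p r : κ → ℝ}
    (hp : ∀ i, 0 < p i) (hr : ∀ i, 0 < r i) (hsum : ∑ i, p i = ∑ i, r i) :
    ∑ i, Real.log (p i) * r i ≤ ∑ i, Real.log (r i) * r i := by
  have key : ∀ i, Real.log (p i) * r i ≤ Real.log (r i) * r i + (p i - r i) := fun i => by
    have hlog := Real.log_le_sub_one_of_pos (div_pos (hp i) (hr i))
    rw [Real.log_div (hp i).ne' (hr i).ne'] at hlog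
    have hmul := mul_le_mul_of_nonneg_right hlog (hr i).le
    rw [sub_mul, sub_mul, div_mul_cancel₀ _ (hr i).ne'] at hmul
    linarith
  calc ∑ i, Real.log (p i) * r i ≤ ∑ i, (Real.log (r i) * r i + (p i - r i)) :=
        Finset.sum_le_sum fun i _ => key i
    _ = ∑ i, Real.log (r i) * r i := by
        rw [Finset.sum_add_distrib, Finset.sum_sub_distrib, hsum, sub_self, add_zero]

/-- In a relational model for probabilities with the overall effect
(`1 ∈ rowspace A`), a strictly positive probability vector `p̂` in the model that
reproduces the observed subset sums (`A p̂ = A q`) maximizes the multinomial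
log-likelihood `ℓ(p) = Σ_i q(i) log p(i)` over the model. -/
theorem multinomial_mle_characterization {J n : ℕ}
    (A : Fin J → Fin n → ℝ) (hA : ∀ j i, A j i = 0 ∨ A j i = 1)
    (hrows : ∀ j, ∃ i, A j i = 1)
    (h1 : (fun _ : Fin n => (1 : ℝ)) ∈ Submodule.span ℝ (Set.range A))
    (q : Fin n → ℝ) (hq : ∀ i, 0 ≤ q i) (hq1 : ∑ i, q i = 1)
    (phat : Fin n → ℝ) (hpos : ∀ i, 0 < phat i) (hphat1 : ∑ i, phat i = 1)
    (hmodel : (fun i => Real.log (phat i)) ∈ Submodule.span ℝ (Set.range A))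
    (hfit : ∀ j, ∑ i, A j i * phat i = ∑ i, A j i * q i) :
    ∀ p : Fin n → ℝ, (∀ i, 0 < p i) → ∑ i, p i = 1 →
      (fun i => Real.log (p i)) ∈ Submodule.span ℝ (Set.range A) →
      ∑ i, q i * Real.log (p i) ≤ ∑ i, q i * Real.log (phat i) := by
  intro p hp hp1 hpmodel
  simp only [mul_comm (q _)]
  rw [← sum_mul_eq_of_mem_span_range hfit hpmodel, ← sum_mul_eq_of_mem_span_range hfit hmodel]
  exact sum_log_mul_le_sum_log_mul_self hp hpos (hp1.trans hphat1.symm)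
end
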